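/- arXiv:1611.00586 — 4 statements merged into one kernel-verified Lean document; each statement's English description precedes it below -/
import Mathlib

section
/- Let F be a real n×n matrix, let Z ⊆ ℝ^n be nonempty and bounded, and let ε > 0. If F Z ⊕ B̄(0,ε) ⊆ Z, where B̄(0,ε) is the closed Euclidean ball of radius ε centered at the origin, then F is Schur, i.e. the spectral radius of F (the maximum modulus of its complex eigenvalues) is strictly less than 1. -/
open Pointwise

/-- Every spectral value of a square matrix over a field admits a left eigenvector. -/
theorem Matrix.exists_vecMul_eq_smul_of_mem_spectrum {ι K : Type*} [Fintype ι] [DecidableEq ι]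
    [Field K] {A : Matrix ι ι K} {μ : K} (hμ : μ ∈ spectrum K A) :
    ∃ w : ι → K, w ≠ 0 ∧ Matrix.vecMul w A = μ • w := by
  rw [spectrum.mem_iff, Matrix.isUnit_iff_isUnit_det, isUnit_iff_ne_zero, not_not,
    ← Matrix.exists_vecMul_eq_zero_iff] at hμ
  obtain ⟨w, hw, h⟩ := hμ
  refine ⟨w, hw, ?_⟩
  rw [Matrix.vecMul_sub, Algebra.algebraMap_eq_smul_one, Matrix.vecMul_smul, Matrix.vecMul_one,
    sub_eq_zero] at h
  exact h.symm

/-- An additive functional `φ` with `φ ∘ T = μ φ` that is nonzero somewhere on a symmetric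
pair of disturbances `±d` forces `‖μ‖ < 1` if it is bounded on a set invariant under
`x ↦ T x ± d`. -/
theorem norm_lt_one_of_bounded_invariant {E : Type*} [AddCommGroup E] {Z : Set E}
    (hne : Z.Nonempty) {T : E → E} {φ : E →+ ℂ} {μ : ℂ} {d : E}
    (hT : ∀ x, φ (T x) = μ * φ x) (hd : φ d ≠ 0)
    (hbdd : BddAbove ((fun z => ‖φ z‖ ^ 2) '' Z))
    (hadd : ∀ z ∈ Z, T z + d ∈ Z) (hsub : ∀ z ∈ Z, T z - d ∈ Z) : ‖μ‖ < 1 := by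
  by_contra! hμ
  have hc : 0 < ‖φ d‖ ^ 2 := by positivity
  obtain ⟨_, ⟨z, hz, rfl⟩, hlt⟩ := exists_lt_of_lt_csSup (hne.image fun z => ‖φ z‖ ^ 2)
    (sub_lt_self (sSup ((fun z => ‖φ z‖ ^ 2) '' Z)) hc)
  have h₁ := le_csSup hbdd ⟨_, hadd z hz, rfl⟩
  have h₂ := le_csSup hbdd ⟨_, hsub z hz, rfl⟩
  simp only [map_add, map_sub, hT] at h₁ h₂ hlt
  have hpar := parallelogram_law_with_norm ℝ (μ * φ z) (φ d)
  have hexp : ‖φ z‖ ≤ ‖μ * φ z‖ := by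
    rw [norm_mul]
    exact le_mul_of_one_le_left (norm_nonneg _) hμ
  have hexp' : ‖φ z‖ ^ 2 ≤ ‖μ * φ z‖ ^ 2 := by gcongr
  nlinarith

/-- If `Z ⊆ ℝ^n` is nonempty and bounded and satisfies
`F Z ⊕ B̄(0, ε) ⊆ Z` for some `ε > 0` (robust positive invariance with a disturbance set
containing a closed Euclidean ball around the origin), then `F` is Schur: its spectral
radius (the maximum modulus of its complex eigenvalues) is strictly less than 1. -/
theorem stmt_3 (n : ℕ) (F : Matrix (Fin n) (Fin n) ℝ)
    (Z : Set (EuclideanSpace ℝ (Fin n)))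
    (hne : Z.Nonempty) (hbdd : Bornology.IsBounded Z)
    (ε : ℝ) (hε : 0 < ε)
    (hinv : ⇑(Matrix.toEuclideanLin F) '' Z + Metric.closedBall 0 ε ⊆ Z) :
    spectralRadius ℂ (F.map Complex.ofReal) < 1 := by
  have hev : ∀ μ ∈ spectrum ℂ (F.map Complex.ofReal), ‖μ‖ < 1 := by
    intro μ hμ
    obtain ⟨w, hw, hwF⟩ := Matrix.exists_vecMul_eq_smul_of_mem_spectrum hμ
    obtain ⟨i, hi⟩ := Function.ne_iff.mp hw
    let φ : EuclideanSpace ℝ (Fin n) →ₗ[ℝ] ℂ :=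
      { toFun := fun x => w ⬝ᵥ fun j => (x j : ℂ)
        map_add' := fun x y => by
          simp [dotProduct, mul_add, Finset.sum_add_distrib]
        map_smul' := fun c x => by
          simp [dotProduct, Finset.mul_sum, mul_left_comm] }
    have hφF (x) : φ (Matrix.toEuclideanLin F x) = μ * φ x := by
      have hcoe : (fun j => ((Matrix.toEuclideanLin F x j : ℝ) : ℂ)) =
          (F.map Complex.ofReal).mulVec fun j => (x j : ℂ) := by
        ext j
        simp [Matrix.mulVec, dotProduct]
      change w ⬝ᵥ _ = μ * (w ⬝ᵥ _)
      rw [hcoe, Matrix.dotProduct_mulVec, hwF, smul_dotProduct, smul_eq_mul]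
    have hd : φ (EuclideanSpace.single i ε) ≠ 0 := by
      have : φ (EuclideanSpace.single i ε) = w i * ε := by
        simp [φ, dotProduct, apply_ite]
      rw [this]
      exact mul_ne_zero hi (by exact_mod_cast hε.ne')
    have hball : EuclideanSpace.single i ε ∈
        Metric.closedBall (0 : EuclideanSpace ℝ (Fin n)) ε := by
      simp [abs_of_pos hε]
    refine norm_lt_one_of_bounded_invariant (φ := φ.toAddMonoidHom) hne hφF hd ?_
      (fun z hz => hinv (Set.add_mem_add ⟨z, hz, rfl⟩ hball)) fun z hz => ?_
    · obtain ⟨C, hC⟩ := ((LinearMap.toContinuousLinearMap φ).lipschitz.isBounded_image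
        hbdd).exists_norm_le
      refine ⟨C ^ 2, ?_⟩
      rintro _ ⟨z, hz, rfl⟩
      exact pow_le_pow_left₀ (norm_nonneg _) (hC _ ⟨z, hz, rfl⟩) 2
    · rw [sub_eq_add_neg]
      exact hinv (Set.add_mem_add ⟨z, hz, rfl⟩ (by simpa using hball))
  have hfin : (spectrum ℂ (F.map Complex.ofReal)).Finite := Matrix.finite_spectrum _
  rcases (spectrum ℂ (F.map Complex.ofReal)).eq_empty_or_nonempty with h | h
  · simp [spectralRadius, h]
  · obtain ⟨μ, hμ, hmax⟩ := hfin.exists_maximalFor (fun k => ‖k‖₊) _ h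
    refine lt_of_le_of_lt (b := (‖μ‖₊ : ENNReal)) (iSup₂_le fun k hk => ?_) ?_
    · exact_mod_cast (le_total ‖k‖₊ ‖μ‖₊).elim id (hmax hk)
    · exact_mod_cast hev μ hμ
end

section
/- Let F be a real n×n matrix with spectral radius strictly less than 1 (F Schur), and let W ⊆ ℝ^n be a nonempty compact set. Then there exists a nonempty compact set Z ⊆ ℝ^n such that F Z ⊕ W ⊆ Z, i.e. Z is robust positively invariant for the disturbed dynamics x_{t+1} = F x_t + w_t with w_t ∈ W. -/
open Pointwise

/-- Gelfand's formula: a power of an element of spectral radius less than one is a contraction. -/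
theorem exists_pow_nnnorm_lt_one_of_spectralRadius_lt_one {A : Type*} [NormedRing A]
    [NormedAlgebra ℂ A] [CompleteSpace A] (a : A) (ha : spectralRadius ℂ a < 1) :
    ∃ N : ℕ, 0 < N ∧ ‖a ^ N‖₊ < 1 := by
  have hev := (spectrum.pow_nnnorm_pow_one_div_tendsto_nhds_spectralRadius a).eventually_lt_const ha
  obtain ⟨N, hN, hpos⟩ := (hev.and (Filter.eventually_gt_atTop 0)).exists
  refine ⟨N, hpos, ?_⟩
  by_contra! h
  exact hN.not_ge (ENNReal.one_le_rpow (by exact_mod_cast h) (by positivity))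

open scoped Matrix.Norms.Operator in
theorem Matrix.exists_norm_pow_mulVec_le_of_spectralRadius_lt_one {ι : Type*} [Fintype ι]
    [DecidableEq ι] (F : Matrix ι ι ℝ) (hF : spectralRadius ℂ (F.map Complex.ofReal) < 1) :
    ∃ N : ℕ, 0 < N ∧ ∃ r : ℝ, r < 1 ∧ ∀ x, ‖(F ^ N).mulVec x‖ ≤ r * ‖x‖ := by
  have : CompleteSpace (Matrix ι ι ℂ) := FiniteDimensional.complete ℂ _
  obtain ⟨N, hN, h⟩ := exists_pow_nnnorm_lt_one_of_spectralRadius_lt_one _ hF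
  have hpow : (F.map Complex.ofReal) ^ N = (F ^ N).map Complex.ofReal :=
    (map_pow (Complex.ofRealHom.mapMatrix (m := ι)) F N).symm
  have hnorm : ‖(F ^ N).map Complex.ofReal‖₊ = ‖F ^ N‖₊ := by
    simp [Matrix.linfty_opNNNorm_def]
  rw [hpow, hnorm] at h
  exact ⟨N, hN, ‖F ^ N‖, h, fun x => Matrix.linfty_opNorm_mulVec _ _⟩

/-- The invariant set is a sublevel set of the adapted norm `x ↦ ∑ k < N, ‖T ^ k x‖`. -/
theorem ContinuousLinearMap.exists_isCompact_image_add_subset {E : Type*}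
    [NormedAddCommGroup E] [NormedSpace ℝ E] [ProperSpace E] (T : E →L[ℝ] E) {N : ℕ} (hN : 0 < N)
    {r : ℝ} (hr : r < 1) (hT : ∀ x, ‖(T ^ N) x‖ ≤ r * ‖x‖) {W : Set E} (hW : IsCompact W) :
    ∃ Z : Set E, Z.Nonempty ∧ IsCompact Z ∧ T '' Z + W ⊆ Z := by
  set V : E → ℝ := fun x => ∑ k ∈ Finset.range N, ‖(T ^ k) x‖ with hV
  have hVcont : Continuous V := by fun_prop
  have hV_ge (x : E) : ‖x‖ ≤ V x := by
    simpa [hV] using Finset.single_le_sum (f := fun k => ‖(T ^ k) x‖) (fun k _ => norm_nonneg _)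
      (Finset.mem_range.2 hN)
  have hV_add (x y : E) : V (x + y) ≤ V x + V y := by
    simp only [hV, map_add, ← Finset.sum_add_distrib]
    exact Finset.sum_le_sum fun k _ => norm_add_le _ _
  set C : ℝ := ∑ k ∈ Finset.range N, ‖T ^ k‖ + (1 - r)
  have hS : 0 ≤ ∑ k ∈ Finset.range N, ‖T ^ k‖ := by positivity
  have hC : 0 < C := by linarith
  have hV_le (x : E) : V x ≤ C * ‖x‖ := by
    have : V x ≤ (∑ k ∈ Finset.range N, ‖T ^ k‖) * ‖x‖ := by
      rw [Finset.sum_mul]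
      exact Finset.sum_le_sum fun k _ => (T ^ k).le_opNorm x
    nlinarith [norm_nonneg x]
  have hV_map (x : E) : V (T x) ≤ V x - (1 - r) * ‖x‖ := by
    have htel : V (T x) + ‖x‖ = V x + ‖(T ^ N) x‖ := by
      have h := Finset.sum_range_succ' (fun k => ‖(T ^ k) x‖) N
      rw [Finset.sum_range_succ] at h
      simpa [hV, pow_succ] using h.symm
    linarith [hT x]
  obtain ⟨M, hM⟩ := hW.bddAbove_image hVcont.continuousOn
  set δ : ℝ := (1 - r) / C
  have hδ : 0 < δ := div_pos (by linarith) hC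
  have hδ_le : δ ≤ 1 := (div_le_one hC).2 (by linarith)
  have hV_contr (x : E) : V (T x) ≤ V x - δ * V x := by
    have h := mul_le_mul_of_nonneg_left (hV_le x) hδ.le
    have hδC : δ * (C * ‖x‖) = (1 - r) * ‖x‖ := by
      rw [← mul_assoc, div_mul_cancel₀ _ hC.ne']
    linarith [hV_map x]
  set R : ℝ := max M 0 / δ
  have hR : 0 ≤ R := by positivity
  have hδR : M ≤ δ * R := by
    rw [mul_div_cancel₀ _ hδ.ne']
    exact le_max_left _ _
  refine ⟨{x | V x ≤ R}, ⟨0, by simpa [hV] using hR⟩, ?_, ?_⟩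
  · refine (isCompact_closedBall (0 : E) R).of_isClosed_subset
      (isClosed_le hVcont continuous_const) fun x hx => ?_
    simpa using (hV_ge x).trans hx
  · rintro _ ⟨_, ⟨x, hx, rfl⟩, w, hw, rfl⟩
    have hx : V x ≤ R := hx
    have hw : V w ≤ M := hM (Set.mem_image_of_mem V hw)
    change V (T x + w) ≤ R
    nlinarith [hV_add (T x) w, hV_contr x]

/-- If `F` is Schur (spectral radius strictly less than 1) and
`W ⊆ ℝ^n` is a nonempty compact set, then there exists a nonempty compact set `Z`
that is robust positively invariant for `F` and disturbance set `W`: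
`F Z ⊕ W ⊆ Z`. -/
theorem stmt_5 (n : ℕ) (F : Matrix (Fin n) (Fin n) ℝ)
    (hF : spectralRadius ℂ (F.map Complex.ofReal) < 1)
    (W : Set (Fin n → ℝ)) (hWne : W.Nonempty) (hWc : IsCompact W) :
    ∃ Z : Set (Fin n → ℝ), Z.Nonempty ∧ IsCompact Z ∧ F.mulVec '' Z + W ⊆ Z := by
  obtain ⟨N, hN, r, hr, h⟩ := F.exists_norm_pow_mulVec_le_of_spectralRadius_lt_one hF
  let T : (Fin n → ℝ) →L[ℝ] (Fin n → ℝ) := F.mulVecLin.toContinuousLinearMap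
  have hpow (k : ℕ) (x : Fin n → ℝ) : (T ^ k) x = (F ^ k).mulVec x := by
    induction k with
    | zero => simp
    | succ k ih =>
      rw [pow_succ', pow_succ', ← Matrix.mulVec_mulVec, ← ih]
      rfl
  exact T.exists_isCompact_image_add_subset hN hr (fun x => hpow N x ▸ h x) hWc
end

section
/- Let A ∈ ℝ^{n×n}, B ∈ ℝ^{n×m}, K ∈ ℝ^{m×n}, F = A + BK, let W ⊆ ℝ^n, and let Z ⊆ ℝ^n satisfy F Z ⊕ W ⊆ Z. Let (x̂_t) and (û_t) be a nominal trajectory with x̂_{t+1} = A x̂_t + B û_t, and let (x_t) be a perturbed trajectory with x_{t+1} = A x_t + B u_t + w_t, where u_t = û_t + K(x_t − x̂_t) and w_t ∈ W for all t ≥ 0. If x_0 − x̂_0 ∈ Z, then x_t − x̂_t ∈ Z for all t ≥ 0. If, moreover, X ⊆ ℝ^n and U ⊆ ℝ^m are sets such that x̂_t + Z ⊆ X (i.e. x̂_t ∈ X ⊖ Z) and û_t + K Z ⊆ U (i.e. û_t ∈ U ⊖ K Z) for all t, then x_t ∈ X and u_t ∈ U for all t ≥ 0. -/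
open Pointwise

/-- **tube containment and constraint satisfaction in tube MPC.**
If `Z` is RPI for `F = A + B K` and disturbance set `W`, the nominal trajectory satisfies
`x̂ (t+1) = A x̂ t + B û t`, the true trajectory satisfies
`x (t+1) = A x t + B u t + w t` with the tube control policy `u t = û t + K (x t − x̂ t)`
and `w t ∈ W`, and initially `x 0 − x̂ 0 ∈ Z`, then `x t − x̂ t ∈ Z` for all `t`; moreover,
for any constraint sets `X`, `U` with `x̂ t + Z ⊆ X` and `û t + K Z ⊆ U` for all `t`
(tightened constraints), we get `x t ∈ X` and `u t ∈ U` for all `t`. -/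
theorem stmt_8 (n m : ℕ)
    (A : Matrix (Fin n) (Fin n) ℝ) (B : Matrix (Fin n) (Fin m) ℝ)
    (K : Matrix (Fin m) (Fin n) ℝ)
    (W Z : Set (Fin n → ℝ))
    (hRPI : (A + B * K).mulVec '' Z + W ⊆ Z)
    (xhat : ℕ → Fin n → ℝ) (uhat : ℕ → Fin m → ℝ)
    (x : ℕ → Fin n → ℝ) (u : ℕ → Fin m → ℝ) (w : ℕ → Fin n → ℝ)
    (hnom : ∀ t, xhat (t + 1) = A.mulVec (xhat t) + B.mulVec (uhat t))
    (hpolicy : ∀ t, u t = uhat t + K.mulVec (x t - xhat t))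
    (hdyn : ∀ t, x (t + 1) = A.mulVec (x t) + B.mulVec (u t) + w t)
    (hw : ∀ t, w t ∈ W)
    (h0 : x 0 - xhat 0 ∈ Z) :
    (∀ t, x t - xhat t ∈ Z) ∧
    ∀ (X : Set (Fin n → ℝ)) (U : Set (Fin m → ℝ)),
      (∀ t, xhat t +ᵥ Z ⊆ X) → (∀ t, uhat t +ᵥ K.mulVec '' Z ⊆ U) →
      ∀ t, x t ∈ X ∧ u t ∈ U := by
  have herr : ∀ t, x t - xhat t ∈ Z := by
    intro t
    induction t with
    | zero => exact h0
    | succ t ih =>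
      have hstep : x (t + 1) - xhat (t + 1) = (A + B * K).mulVec (x t - xhat t) + w t := by
        rw [hdyn, hnom, hpolicy, Matrix.mulVec_add, Matrix.add_mulVec, Matrix.mulVec_mulVec,
          Matrix.mulVec_sub A]
        abel
      rw [hstep]
      exact hRPI (Set.add_mem_add (Set.mem_image_of_mem _ ih) (hw t))
  refine ⟨herr, fun X U hX hU t => ⟨?_, ?_⟩⟩
  · exact hX t ⟨x t - xhat t, herr t, add_sub_cancel _ _⟩
  · rw [hpolicy]
    exact hU t (Set.vadd_mem_vadd_set (Set.mem_image_of_mem _ (herr t)))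
end

section
/- Let A = [[2.070, 1.924], [0.316, 0.203]], B = [[0.660, −1.274], [0.113, 0.810]], K = diag(−2.924, 0.977), and F = A + BK, so that F = [[0.14016, 0.679302], [−0.014412, 0.99437]]. Then: (i) |F_11| < 1, |F_22| < 1, and the spectral radius of F is strictly less than 1 (F is Schur); but (ii) there exist no compact sets Z_1, Z_2 ⊆ ℝ, each containing at least two points, such that F (Z_1 × Z_2) ⊆ Z_1 × Z_2; that is, F admits no 'square' (product-form) compact positively invariant set with non-singleton factors. -/
open Pointwise

/-- Complex roots of `x ^ 2 - t * x + d` have modulus at most `r` when the discriminant is positive,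
`r` exceeds half of `|t|`, and the polynomial is positive at `r` and at `-r`. -/
lemma norm_le_of_quadratic_root {t d r : ℝ} {z : ℂ} (hdisc : 4 * d < t ^ 2)
    (ht : |t| < 2 * r) (hr : 0 < r ^ 2 - t * r + d) (hr' : 0 < r ^ 2 + t * r + d)
    (hz : z ^ 2 - t * z + d = 0) : ‖z‖ ≤ r := by
  obtain ⟨ht1, ht2⟩ := abs_lt.1 ht
  have hre := congrArg Complex.re hz
  have him := congrArg Complex.im hz
  simp [pow_two] at hre him
  have h0 : z.im * (2 * z.re - t) = 0 := by linarith
  have him0 : z.im = 0 := by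
    rcases mul_eq_zero.1 h0 with h | h
    · exact h
    · have : z.re = t / 2 := by linarith
      rw [this] at hre
      nlinarith [sq_nonneg z.im]
  have hzre : z = (z.re : ℂ) := Complex.ext rfl (by simp [him0])
  rw [him0] at hre
  rw [hzre, Complex.norm_real, Real.norm_eq_abs, abs_le]
  constructor
  · by_contra! h
    nlinarith
  · by_contra! h
    nlinarith

/-- A nontrivial compact set of reals has a least and a greatest element, and they differ. -/
lemma exists_isLeast_isGreatest_lt {Z : Set ℝ} (hZ : IsCompact Z) (hZ' : Z.Nontrivial) :
    ∃ a b, IsLeast Z a ∧ IsGreatest Z b ∧ a < b := by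
  obtain ⟨a, ha⟩ := hZ.exists_isLeast hZ'.nonempty
  obtain ⟨b, hb⟩ := hZ.exists_isGreatest hZ'.nonempty
  obtain ⟨x, hx, y, hy, hxy⟩ := hZ'.exists_lt
  exact ⟨a, b, ha, hb, (ha.2 hx).trans_lt (hxy.trans_le (hb.2 hy))⟩

/-- **the paper's Case 3: non-existence of square PI sets.**
For `A = [[2.070, 1.924], [0.316, 0.203]]`, `B = [[0.660, −1.274], [0.113, 0.810]]`,
`K = diag(−2.924, 0.977)` and `F = A + B K = [[0.14016, 0.679302], [−0.014412, 0.99437]]`: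
(i) `|F₁₁| < 1`, `|F₂₂| < 1` and `F` is Schur (spectral radius < 1); but
(ii) there is no compact product set `Z₁ × Z₂` with non-singleton factors that is
positively invariant for `F`. -/
theorem stmt_10
    (A : Matrix (Fin 2) (Fin 2) ℝ) (hA : A = !![2.070, 1.924; 0.316, 0.203])
    (B : Matrix (Fin 2) (Fin 2) ℝ) (hB : B = !![0.660, -1.274; 0.113, 0.810])
    (K : Matrix (Fin 2) (Fin 2) ℝ) (hK : K = !![-2.924, 0; 0, 0.977])
    (F : Matrix (Fin 2) (Fin 2) ℝ) (hF : F = A + B * K) :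
    F = !![0.14016, 0.679302; -0.014412, 0.99437] ∧
    |F 0 0| < 1 ∧ |F 1 1| < 1 ∧
    spectralRadius ℂ (F.map Complex.ofReal) < 1 ∧
    ¬ ∃ (Z₁ Z₂ : Set ℝ), IsCompact Z₁ ∧ IsCompact Z₂ ∧
        Z₁.Nontrivial ∧ Z₂.Nontrivial ∧
        F.mulVec '' {x : Fin 2 → ℝ | x 0 ∈ Z₁ ∧ x 1 ∈ Z₂}
          ⊆ {x : Fin 2 → ℝ | x 0 ∈ Z₁ ∧ x 1 ∈ Z₂} := by
  have hF' : F = !![0.14016, 0.679302; -0.014412, 0.99437] := by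
    subst hA hB hK hF
    ext i j
    fin_cases i <;> fin_cases j <;> norm_num [Matrix.mul_apply, Fin.sum_univ_two]
  clear hF hA hB hK
  subst hF'
  refine ⟨rfl, ?_, ?_, ?_, ?_⟩
  · norm_num [abs_lt]
  · norm_num [abs_lt]
  · refine lt_of_le_of_lt (b := ((0.99 : NNReal) : ENNReal)) (iSup₂_le fun z hz => ?_) ?_
    · rw [spectrum.mem_iff, Matrix.isUnit_iff_isUnit_det, isUnit_iff_ne_zero, not_not,
        Matrix.det_fin_two] at hz
      simp [Matrix.algebraMap_matrix_apply] at hz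
      rw [ENNReal.coe_le_coe, ← NNReal.coe_le_coe, coe_nnnorm]
      refine norm_le_of_quadratic_root (t := 1.13453) (d := 0.149160999624) ?_ ?_ ?_ ?_ ?_
      · norm_num
      · norm_num [abs_lt]
      · norm_num
      · norm_num
      · push_cast
        linear_combination hz
    · rw [← ENNReal.coe_one, ENNReal.coe_lt_coe, ← NNReal.coe_lt_coe]
      norm_num
  · rintro ⟨Z₁, Z₂, hc₁, hc₂, hn₁, hn₂, hinv⟩
    obtain ⟨a, b, ha, hb, hab⟩ := exists_isLeast_isGreatest_lt hc₁ hn₁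
    obtain ⟨c, d, hc, hd, hcd⟩ := exists_isLeast_isGreatest_lt hc₂ hn₂
    have key : ∀ x ∈ Z₁, ∀ y ∈ Z₂,
        0.14016 * x + 0.679302 * y ∈ Z₁ ∧ -0.014412 * x + 0.99437 * y ∈ Z₂ := by
      intro x hx y hy
      have h := hinv ⟨![x, y], ⟨hx, hy⟩, rfl⟩
      simpa [Matrix.mulVec, dotProduct, Fin.sum_univ_two, mul_comm] using h
    have h₁ := hb.2 (key b hb.1 d hd.1).1
    have h₂ := ha.2 (key a ha.1 c hc.1).1
    have h₃ := hd.2 (key a ha.1 d hd.1).2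
    have h₄ := hc.2 (key b hb.1 c hc.1).2
    linarith
end
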